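/- arXiv:1312.3378 — 2 statements merged into one kernel-verified Lean document; each statement's English description precedes it below -/
import Mathlib

section
/- Let μ ∈ ℝⁿ, C ∈ ℝⁿˣⁿ symmetric positive definite, U ∈ ℝ^{l×n} (l ≤ n) of full row rank, t : ℝˡ → [0,∞) measurable, and Z = ∫ t(Ux) N(x;μ,C) dx ∈ (0,∞). Assume the tilted distributions below have finite first moments. Then the mean μ* of the density Z⁻¹ t(Ux) N(x;μ,C) on ℝⁿ satisfies μ* = μ + CUᵗ(UCUᵗ)⁻¹(s̄ − Uμ), where s̄ ∈ ℝˡ is the mean of the density Z⁻¹ t(s) N(s;Uμ,UCUᵗ) on ℝˡ. -/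
open MeasureTheory Matrix

noncomputable def gaussianD {ι : Type} [Fintype ι] [DecidableEq ι]
    (μ : ι → ℝ) (C : Matrix ι ι ℝ) (x : ι → ℝ) : ℝ :=
  (2 * Real.pi) ^ (-(Fintype.card ι : ℝ) / 2) * C.det ^ (-(1 : ℝ) / 2) *
    Real.exp (-(1 / 2) * ((x - μ) ⬝ᵥ (C⁻¹ *ᵥ (x - μ))))

open MeasureTheory

lemma Matrix.vecMul_injective_of_rank_eq_card {ι κ K : Type*} [Fintype ι] [Fintype κ] [Field K]
    {U : Matrix κ ι K} (hU : U.rank = Fintype.card κ) :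
    Function.Injective U.vecMul := by
  rw [vecMul_injective_iff, linearIndependent_iff_card_eq_finrank_span, ← hU,
    rank_eq_finrank_span_row]
  rfl

section GaussianMeasure

open ProbabilityTheory

variable {ι κ : Type} [Fintype ι] [DecidableEq ι] [Fintype κ] [DecidableEq κ]

/-- The measure on `ι → ℝ` with density `gaussianD μ C`. -/
noncomputable def gaussianMeasure (μ : ι → ℝ) (C : Matrix ι ι ℝ) : Measure (ι → ℝ) :=
  volume.withDensity fun x => ENNReal.ofReal (gaussianD μ C x)

lemma continuous_gaussianD (μ : ι → ℝ) (C : Matrix ι ι ℝ) : Continuous (gaussianD μ C) := by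
  unfold gaussianD
  fun_prop

lemma gaussianD_nonneg (μ : ι → ℝ) {C : Matrix ι ι ℝ} (hC : 0 ≤ C.det) (x : ι → ℝ) :
    0 ≤ gaussianD μ C x := by
  unfold gaussianD
  positivity

lemma gaussianD_zero_one (x : ι → ℝ) :
    gaussianD 0 1 x = ∏ i, gaussianPDFReal 0 1 (x i) := by
  simp only [gaussianD, gaussianPDFReal, Finset.prod_mul_distrib, ← Real.exp_sum, sub_zero,
    det_one, Real.one_rpow, mul_one, inv_one, one_mulVec, NNReal.coe_one, Finset.prod_const,
    Finset.card_univ, dotProduct]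
  congr 1
  · rw [Real.sqrt_eq_rpow, ← Real.rpow_neg (by positivity), ← Real.rpow_natCast,
      ← Real.rpow_mul (by positivity)]
    congr 1
    ring
  · rw [Finset.mul_sum]
    congr 1
    exact Finset.sum_congr rfl fun i _ => by ring

lemma pi_gaussianReal_eq :
    Measure.pi (fun _ : ι => gaussianReal 0 1) = gaussianMeasure 0 1 := by
  refine Measure.pi_eq fun s hs => ?_
  have hint (i : ι) : Integrable ((s i).indicator (gaussianPDFReal 0 1)) :=
    (integrable_gaussianPDFReal 0 1).indicator (hs i)
  have hnn (i : ι) (x : ℝ) : 0 ≤ (s i).indicator (gaussianPDFReal 0 1) x :=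
    Set.indicator_nonneg (fun _ _ => gaussianPDFReal_nonneg _ _ _) _
  have hind (x : ι → ℝ) : (Set.univ.pi s).indicator (gaussianD 0 1) x =
      ∏ i, (s i).indicator (gaussianPDFReal 0 1) (x i) := by
    by_cases hx : x ∈ Set.univ.pi s
    · rw [Set.indicator_of_mem hx, gaussianD_zero_one]
      exact Finset.prod_congr rfl fun i _ => (Set.indicator_of_mem (hx i trivial) _).symm
    · rw [Set.indicator_of_notMem hx]
      obtain ⟨i, hi⟩ : ∃ i, x i ∉ s i := by simpa [Set.mem_pi] using hx
      exact (Finset.prod_eq_zero (Finset.mem_univ i) (Set.indicator_of_notMem hi _)).symm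
  have hreal (i : ι) : gaussianReal 0 1 (s i) =
      ENNReal.ofReal (∫ x, (s i).indicator (gaussianPDFReal 0 1) x) := by
    rw [gaussianReal_apply_eq_integral _ one_ne_zero, integral_indicator (hs i)]
  simp_rw [hreal]
  rw [gaussianMeasure, withDensity_apply _ (MeasurableSet.univ_pi hs),
    ← ofReal_integral_eq_lintegral_ofReal, ← integral_indicator (MeasurableSet.univ_pi hs),
    ← ENNReal.ofReal_prod_of_nonneg fun i _ => integral_nonneg (hnn i)]
  · simp_rw [hind]
    rw [integral_fintype_prod_volume_eq_prod]
  · rw [← IntegrableOn, ← integrable_indicator_iff (MeasurableSet.univ_pi hs), funext hind]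
    exact Integrable.fintype_prod hint
  · exact ae_of_all _ fun x => gaussianD_nonneg _ (by simp) x

lemma charFunDual_map_pi_gaussianReal (M : Matrix κ ι ℝ) (L : StrongDual ℝ (κ → ℝ)) :
    charFunDual ((Measure.pi fun _ : ι => gaussianReal 0 1).map (M *ᵥ ·)) L =
      Complex.exp (-((fun j => L (Pi.single j 1)) ⬝ᵥ (M * Mᵀ) *ᵥ fun j => L (Pi.single j 1) : ℝ)
        / 2) := by
  have hreal (l : StrongDual ℝ ℝ) :
      charFunDual (gaussianReal 0 1) l = Complex.exp (-(l 1 : ℂ) ^ 2 / 2) := by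
    have := charFun_gaussianReal (μ := 0) (v := 1) (l 1)
    rw [charFun_apply_real] at this
    rw [charFunDual_apply]
    convert this using 4 with x
    · rw [← Complex.ofReal_mul]
      congr 2
      simpa [mul_comm] using l.map_smul x 1
    · simp [neg_div]
  have hL (v : κ → ℝ) : L v = v ⬝ᵥ fun j => L (Pi.single j 1) := by
    conv_lhs => rw [← Finset.univ_sum_single v, map_sum]
    refine Finset.sum_congr rfl fun j _ => ?_
    rw [← smul_eq_mul, ← map_smul, ← Pi.single_smul, smul_eq_mul, mul_one]
  have hM : (M *ᵥ · : (ι → ℝ) → κ → ℝ) = M.mulVecLin.toContinuousLinearMap := rfl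
  rw [hM, charFunDual_map, charFunDual_pi]
  simp_rw [hreal]
  rw [← Complex.exp_sum, ← mulVec_mulVec, dotProduct_mulVec]
  congr 1
  rw [← Finset.sum_div, Finset.sum_neg_distrib, dotProduct, Complex.ofReal_sum]
  congr 2
  refine Finset.sum_congr rfl fun i _ => ?_
  rw [mulVec_transpose, ← sq, ← Complex.ofReal_pow]
  congr 2
  simp only [ContinuousLinearMap.comp_apply, ContinuousLinearMap.single_apply,
    LinearMap.coe_toContinuousLinearMap', mulVecLin_apply]
  rw [hL, mulVec_single_one, dotProduct_comm]
  rfl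

lemma map_pi_gaussianReal_congr {ι' : Type} [Fintype ι'] [DecidableEq ι'] {M : Matrix κ ι ℝ}
    {N : Matrix κ ι' ℝ} (h : M * Mᵀ = N * Nᵀ) :
    (Measure.pi fun _ : ι => gaussianReal 0 1).map (M *ᵥ ·) =
      (Measure.pi fun _ : ι' => gaussianReal 0 1).map (N *ᵥ ·) := by
  have : IsProbabilityMeasure ((Measure.pi fun _ : ι => gaussianReal 0 1).map (M *ᵥ ·)) :=
    Measure.isProbabilityMeasure_map (by fun_prop)
  have : IsProbabilityMeasure ((Measure.pi fun _ : ι' => gaussianReal 0 1).map (N *ᵥ ·)) :=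
    Measure.isProbabilityMeasure_map (by fun_prop)
  refine Measure.ext_of_charFunDual (funext fun L => ?_)
  rw [charFunDual_map_pi_gaussianReal, charFunDual_map_pi_gaussianReal, h]

lemma gaussianD_add_mulVec (μ : ι → ℝ) {A : Matrix ι ι ℝ} (hA : A.det ≠ 0) (x : ι → ℝ) :
    gaussianD μ (A * Aᵀ) (μ + A *ᵥ x) = |A.det|⁻¹ * gaussianD 0 1 x := by
  have hdet : (A * Aᵀ).det ^ (-(1 : ℝ) / 2) = |A.det|⁻¹ := by
    rw [det_mul, det_transpose, ← abs_mul_abs_self, neg_div, Real.rpow_neg (by positivity),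
      ← Real.sqrt_eq_rpow, Real.sqrt_mul_self (abs_nonneg _)]
  have hquad : (A *ᵥ x) ⬝ᵥ ((A * Aᵀ)⁻¹ *ᵥ (A *ᵥ x)) = x ⬝ᵥ x := by
    have hu : IsUnit A.det := hA.isUnit
    have hut : IsUnit Aᵀ.det := by rwa [det_transpose]
    rw [mulVec_mulVec, Matrix.mul_inv_rev, Matrix.mul_assoc, Matrix.nonsing_inv_mul _ hu,
      Matrix.mul_one, dotProduct_mulVec, ← mulVec_transpose, mulVec_mulVec, transpose_nonsing_inv,
      transpose_transpose, Matrix.nonsing_inv_mul _ hu, one_mulVec]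
  simp only [gaussianD, hdet, add_sub_cancel_left, hquad, sub_zero, det_one, Real.one_rpow,
    inv_one, one_mulVec]
  ring

lemma gaussianMeasure_mul_transpose (μ : ι → ℝ) {A : Matrix ι ι ℝ} (hA : A.det ≠ 0) :
    gaussianMeasure μ (A * Aᵀ) =
      (Measure.pi fun _ : ι => gaussianReal 0 1).map (fun x => μ + A *ᵥ x) := by
  have hvol (F : (ι → ℝ) → ENNReal) (hF : Measurable F) :
      ∫⁻ y, F y = ENNReal.ofReal |A.det| * ∫⁻ x, F (μ + A *ᵥ x) := by
    have h := congrArg (fun ν => ∫⁻ y, F (μ + y) ∂ν)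
      (Real.map_matrix_volume_pi_eq_smul_volume_pi hA)
    simp only [lintegral_smul_measure, smul_eq_mul] at h
    rw [lintegral_map (by fun_prop) (toLin' A).continuous_of_finiteDimensional.measurable,
      lintegral_add_left_eq_self F μ] at h
    simp only [toLin'_apply] at h
    rw [h, ← mul_assoc, ← ENNReal.ofReal_mul (abs_nonneg _), ← abs_mul, mul_inv_cancel₀ hA]
    simp
  rw [pi_gaussianReal_eq]
  ext s hs
  have hmeas : Measurable fun x : ι → ℝ => μ + A *ᵥ x := by fun_prop
  rw [Measure.map_apply hmeas hs, gaussianMeasure, gaussianMeasure, withDensity_apply _ hs,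
    withDensity_apply _ (hmeas hs), ← lintegral_indicator hs, ← lintegral_indicator (hmeas hs),
    hvol _ ((continuous_gaussianD μ (A * Aᵀ)).measurable.ennreal_ofReal.indicator hs),
    ← lintegral_const_mul']
  · refine lintegral_congr fun x => ?_
    by_cases hx : μ + A *ᵥ x ∈ s
    · rw [Set.indicator_of_mem hx, Set.indicator_of_mem (by exact hx), gaussianD_add_mulVec μ hA,
        ← ENNReal.ofReal_mul (abs_nonneg _), mul_inv_cancel_left₀ (abs_ne_zero.2 hA)]
    · rw [Set.indicator_of_notMem hx, Set.indicator_of_notMem (by exact hx), mul_zero]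
  · exact ENNReal.ofReal_ne_top

lemma Matrix.PosDef.exists_mul_transpose {C : Matrix ι ι ℝ} (hC : C.PosDef) :
    ∃ A : Matrix ι ι ℝ, A.det ≠ 0 ∧ A * Aᵀ = C := by
  obtain ⟨B, hB⟩ : ∃ B : Matrix ι ι ℝ, C = Bᴴ * B := by
    open scoped MatrixOrder in
    exact CStarAlgebra.nonneg_iff_eq_star_mul_self.mp hC.posSemidef.nonneg
  rw [conjTranspose_eq_transpose_of_trivial] at hB
  refine ⟨Bᵀ, fun h => hC.det_pos.ne' ?_, by rw [transpose_transpose, hB]⟩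
  rw [hB, det_mul, h, zero_mul]

/-- Affine images of nondegenerate Gaussian measures are Gaussian. -/
lemma map_gaussianMeasure (μ b : κ → ℝ) (m : ι → ℝ) {C : Matrix ι ι ℝ} (hC : C.PosDef)
    {D : Matrix κ κ ℝ} (hD : D.PosDef) (M : Matrix κ ι ℝ) (hM : M * C * Mᵀ = D)
    (hμ : b + M *ᵥ m = μ) :
    (gaussianMeasure m C).map (fun x => b + M *ᵥ x) = gaussianMeasure μ D := by
  obtain ⟨A, hA, rfl⟩ := hC.exists_mul_transpose
  obtain ⟨B, hB, rfl⟩ := hD.exists_mul_transpose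
  have h : (M * A) * (M * A)ᵀ = B * Bᵀ := by
    rw [← hM, transpose_mul]
    simp only [Matrix.mul_assoc]
  rw [gaussianMeasure_mul_transpose m hA, gaussianMeasure_mul_transpose μ hB,
    Measure.map_map (by fun_prop) (by fun_prop)]
  have := congrArg (Measure.map (μ + ·)) (map_pi_gaussianReal_congr h)
  rw [Measure.map_map (by fun_prop) (by fun_prop),
    Measure.map_map (by fun_prop) (by fun_prop)] at this
  refine Eq.trans ?_ this
  congr 1
  ext1 x
  simp [mulVec_add, ← hμ, add_assoc, mulVec_mulVec]

section Integral

variable {E : Type*} [NormedAddCommGroup E] [NormedSpace ℝ E] {C : Matrix ι ι ℝ}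

lemma integral_gaussianMeasure (μ : ι → ℝ) (hC : 0 ≤ C.det) (f : (ι → ℝ) → E) :
    ∫ x, f x ∂gaussianMeasure μ C = ∫ x, gaussianD μ C x • f x := by
  rw [gaussianMeasure, integral_withDensity_eq_integral_toReal_smul
    (continuous_gaussianD μ C).measurable.ennreal_ofReal (by simp)]
  simp_rw [ENNReal.toReal_ofReal (gaussianD_nonneg μ hC _)]

lemma integrable_gaussianMeasure_iff (μ : ι → ℝ) (hC : 0 ≤ C.det) (f : (ι → ℝ) → E) :
    Integrable f (gaussianMeasure μ C) ↔ Integrable fun x => gaussianD μ C x • f x := by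
  rw [gaussianMeasure, integrable_withDensity_iff_integrable_smul'
    (continuous_gaussianD μ C).measurable.ennreal_ofReal (by simp)]
  simp_rw [ENNReal.toReal_ofReal (gaussianD_nonneg μ hC _)]

end Integral

/-- If `w` is a function of `U *ᵥ x` with integral one under a Gaussian law, then the `w`-weighted
mean only differs from `μ` in the directions spanned by `C * Uᵀ`. -/
lemma integral_smul_gaussianMeasure (μ : ι → ℝ) {C : Matrix ι ι ℝ} (hC : C.PosDef)
    (U : Matrix κ ι ℝ) (hS : (U * C * Uᵀ).PosDef) (w : (κ → ℝ) → ℝ) (hw : Measurable w)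
    (hint : Integrable (fun x => w (U *ᵥ x)) (gaussianMeasure μ C))
    (hone : ∫ x, w (U *ᵥ x) ∂gaussianMeasure μ C = 1)
    (hint' : Integrable (fun x => w (U *ᵥ x) • x) (gaussianMeasure μ C)) :
    ∫ x, w (U *ᵥ x) • x ∂gaussianMeasure μ C =
      μ + (C * Uᵀ * (U * C * Uᵀ)⁻¹) *ᵥ
        ((∫ s, w s • s ∂gaussianMeasure (U *ᵥ μ) (U * C * Uᵀ)) - U *ᵥ μ) := by
  have hCt : Cᵀ = C := by simpa using hC.isHermitian.eq
  have hu : IsUnit (U * C * Uᵀ).det := hS.det_pos.ne'.isUnit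
  set S := U * C * Uᵀ with hSdef
  set K := C * Uᵀ * S⁻¹ with hK
  set m := ∫ x, w (U *ᵥ x) • x ∂gaussianMeasure μ C with hm
  have hSt : Sᵀ = S := by simpa using hS.isHermitian.eq
  have hUK : U * K = 1 := by
    rw [hK, ← Matrix.mul_assoc, ← Matrix.mul_assoc, ← hSdef, Matrix.mul_nonsing_inv _ hu]
  have hPC : C * (K * U)ᵀ = K * U * C := by
    rw [hK]
    simp only [transpose_mul, transpose_nonsing_inv, hSt, hCt, transpose_transpose,
      Matrix.mul_assoc]
  have hPP : (K * U) * (K * U) = K * U := by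
    rw [Matrix.mul_assoc, ← Matrix.mul_assoc U, hUK, Matrix.one_mul]
  -- the reflection fixing the range of `K * U` and negating its kernel
  set R := (2 : ℝ) • (K * U) - 1 with hR
  have hRC : R * C * Rᵀ = C := by
    have hCR : C * Rᵀ = R * C := by
      simp only [hR, transpose_sub, transpose_smul, transpose_one, Matrix.mul_sub, Matrix.sub_mul,
        Matrix.mul_smul, Matrix.smul_mul, hPC, Matrix.mul_one, Matrix.one_mul]
    have hRR : R * R = 1 := by
      simp only [hR, Matrix.mul_sub, Matrix.sub_mul, Matrix.smul_mul, Matrix.mul_smul, hPP,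
        Matrix.mul_one, Matrix.one_mul]
      module
    rw [Matrix.mul_assoc, hCR, ← Matrix.mul_assoc, hRR, Matrix.one_mul]
  have hUR : U * R = U := by
    rw [hR, Matrix.mul_sub, Matrix.mul_smul, ← Matrix.mul_assoc, hUK, Matrix.one_mul,
      Matrix.mul_one]
    module
  have hUx (x : ι → ℝ) : U *ᵥ (μ - R *ᵥ μ + R *ᵥ x) = U *ᵥ x := by
    rw [mulVec_add, mulVec_sub, mulVec_mulVec, mulVec_mulVec, hUR]
    abel
  have hmap := map_gaussianMeasure μ (μ - R *ᵥ μ) μ hC hC R hRC (by abel)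
  have hmapU := map_gaussianMeasure (U *ᵥ μ) 0 μ hC hS U rfl (by simp)
  have hsmul {k : Type} [Fintype k] (M : Matrix k ι ℝ) :
      ∫ x, w (U *ᵥ x) • M *ᵥ x ∂gaussianMeasure μ C = M *ᵥ m := by
    have := M.mulVecLin.toContinuousLinearMap.integral_comp_comm hint'
    simpa [mulVec_smul] using this
  have hsbar : ∫ s, w s • s ∂gaussianMeasure (U *ᵥ μ) S = U *ᵥ m := by
    rw [← hmapU, integral_map (by fun_prop) (by fun_prop), ← hsmul U]
    simp
  have hrefl : m = (μ - R *ᵥ μ) + R *ᵥ m := by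
    have hintR : Integrable (fun x => w (U *ᵥ x) • R *ᵥ x) (gaussianMeasure μ C) := by
      have := R.mulVecLin.toContinuousLinearMap.integrable_comp hint'
      simpa [mulVec_smul] using this
    have hmeas := hint'.aestronglyMeasurable
    rw [← hmap] at hmeas
    conv_lhs => rw [hm, ← hmap]
    rw [integral_map (by fun_prop) hmeas]
    simp_rw [hUx, smul_add]
    rw [integral_add (hint.smul_const _) hintR, integral_smul_const, hone, hsmul, one_smul]
  rw [hsbar, ← mulVec_sub, mulVec_mulVec, mulVec_sub]
  simp only [hR, sub_mulVec, smul_mulVec, one_mulVec] at hrefl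
  ext i
  have hi := congrFun hrefl i
  simp only [Pi.add_apply, Pi.sub_apply, Pi.smul_apply, smul_eq_mul] at hi ⊢
  linarith

end GaussianMeasure

/-- The mean `μ*` of the tilted density `Z⁻¹ t(Ux) N(x;μ,C)` on ℝⁿ
satisfies `μ* = μ + CUᵗ(UCUᵗ)⁻¹(s̄ - Uμ)`, where `s̄` is the mean of the density
`Z⁻¹ t(s) N(s;Uμ,UCUᵗ)` on ℝˡ. -/
theorem stmt12 {l n : ℕ} (hln : l ≤ n) (μ : Fin n → ℝ)
    (C : Matrix (Fin n) (Fin n) ℝ) (hC : C.PosDef) (hCsymm : C.IsSymm)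
    (U : Matrix (Fin l) (Fin n) ℝ) (hU : U.rank = l)
    (t : (Fin l → ℝ) → ℝ) (ht0 : ∀ s, 0 ≤ t s) (htm : Measurable t)
    (Z : ℝ) (hZ : Z = ∫ x : Fin n → ℝ, t (U *ᵥ x) * gaussianD μ C x)
    (hZpos : 0 < Z)
    (hm1 : Integrable (fun x : Fin n → ℝ =>
      (Z⁻¹ * (t (U *ᵥ x) * gaussianD μ C x)) • x))
    (hm1' : Integrable (fun s : Fin l → ℝ =>
      (Z⁻¹ * (t s * gaussianD (U *ᵥ μ) (U * C * Uᵀ) s)) • s))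
    (sbar : Fin l → ℝ)
    (hsbar : sbar = ∫ s : Fin l → ℝ,
      (Z⁻¹ * (t s * gaussianD (U *ᵥ μ) (U * C * Uᵀ) s)) • s) :
    (∫ x : Fin n → ℝ, (Z⁻¹ * (t (U *ᵥ x) * gaussianD μ C x)) • x)
      = μ + (C * Uᵀ * (U * C * Uᵀ)⁻¹) *ᵥ (sbar - U *ᵥ μ) := by
  have hS : (U * C * Uᵀ).PosDef := by
    have := hC.mul_mul_conjTranspose_same
      (vecMul_injective_of_rank_eq_card (hU.trans (Fintype.card_fin l).symm))
    rwa [conjTranspose_eq_transpose_of_trivial] at this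
  have hZint : Integrable fun x : Fin n → ℝ => t (U *ᵥ x) * gaussianD μ C x := by
    by_contra h
    rw [integral_undef h] at hZ
    exact hZpos.ne' hZ
  have hdens {k : ℕ} (m : Fin k → ℝ) (D : Matrix (Fin k) (Fin k) ℝ) (a : ℝ) (x : Fin k → ℝ) :
      (Z⁻¹ * (a * gaussianD m D x)) • x = gaussianD m D x • (Z⁻¹ * a) • x := by
    rw [smul_smul]
    congr 1
    ring
  have hdens' (x : Fin n → ℝ) : gaussianD μ C x • (Z⁻¹ * t (U *ᵥ x)) =
      Z⁻¹ * (t (U *ᵥ x) * gaussianD μ C x) := by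
    rw [smul_eq_mul]
    ring
  have hdC := hC.det_pos.le
  simp only [hdens] at hm1 hsbar ⊢
  rw [← integral_gaussianMeasure _ hS.det_pos.le] at hsbar
  rw [← integrable_gaussianMeasure_iff _ hdC] at hm1
  rw [← integral_gaussianMeasure _ hdC, hsbar]
  refine integral_smul_gaussianMeasure μ hC U hS (fun s => Z⁻¹ * t s) (htm.const_mul _) ?_ ?_ hm1
  · rw [integrable_gaussianMeasure_iff _ hdC]
    simp only [hdens']
    exact hZint.const_mul _
  · rw [integral_gaussianMeasure _ hdC]
    simp only [hdens']
    rw [integral_const_mul, ← hZ, inv_mul_cancel₀ hZpos.ne']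
end

section
/- Let C ∈ ℝⁿˣⁿ be symmetric positive definite, U ∈ ℝ^{l×n} of full row rank, Ĉ = UCUᵗ, and V ∈ ℝˡˣˡ symmetric positive definite. Define C* = C + CUᵗĈ⁻¹(V − Ĉ)Ĉ⁻¹UC and assume C* is invertible. Then (C*)⁻¹ − C⁻¹ = Uᵗ (V⁻¹ − Ĉ⁻¹) U. -/
open MeasureTheory Matrix

/-- A congruence `U * C * Uᵀ` of a positive definite real matrix by a matrix of full row rank is
positive definite. -/
theorem posDef_mul_mul_transpose_of_rank_eq {l n : ℕ} {C : Matrix (Fin n) (Fin n) ℝ}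
    (hC : C.PosDef) {U : Matrix (Fin l) (Fin n) ℝ} (hU : U.rank = l) :
    (U * C * Uᵀ).PosDef := by
  have hrows : LinearIndependent ℝ U.row := by
    rw [linearIndependent_iff_card_eq_finrank_span, Set.finrank,
      ← Matrix.rank_eq_finrank_span_row, hU, Fintype.card_fin]
  simpa only [Matrix.conjTranspose_eq_transpose_of_trivial] using
    hC.mul_mul_conjTranspose_same (Matrix.vecMul_injective_iff.mpr hrows)

/-- Precision-parameter update of the Gaussian factor approximation in
projected EP: with `Ĉ = UCUᵗ` and `C* = C + CUᵗĈ⁻¹(V - Ĉ)Ĉ⁻¹UC` invertible,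
`(C*)⁻¹ - C⁻¹ = Uᵗ(V⁻¹ - Ĉ⁻¹)U`. -/
theorem stmt16 {l n : ℕ} (C : Matrix (Fin n) (Fin n) ℝ) (hC : C.PosDef) (hCsymm : C.IsSymm)
    (U : Matrix (Fin l) (Fin n) ℝ) (hU : U.rank = l)
    (V : Matrix (Fin l) (Fin l) ℝ) (hV : V.PosDef) (hVsymm : V.IsSymm)
    (Chat : Matrix (Fin l) (Fin l) ℝ) (hChat : Chat = U * C * Uᵀ)
    (Cstar : Matrix (Fin n) (Fin n) ℝ)
    (hCstar : Cstar = C + C * Uᵀ * Chat⁻¹ * (V - Chat) * Chat⁻¹ * U * C)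
    (hCstarInv : IsUnit Cstar.det) :
    Cstar⁻¹ - C⁻¹ = Uᵀ * (V⁻¹ - Chat⁻¹) * U := by
  have hCu : IsUnit C.det := C.isUnit_iff_isUnit_det.mp hC.isUnit
  have hVu : IsUnit V.det := V.isUnit_iff_isUnit_det.mp hV.isUnit
  have hHu : IsUnit Chat.det := by
    rw [hChat]
    exact (Matrix.isUnit_iff_isUnit_det _).mp (posDef_mul_mul_transpose_of_rank_eq hC hU).isUnit
  have hzero : (V⁻¹ - Chat⁻¹) + Chat⁻¹ * (V - Chat) * Chat⁻¹
      + Chat⁻¹ * (V - Chat) * Chat⁻¹ * Chat * (V⁻¹ - Chat⁻¹) = 0 := by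
    rw [Matrix.nonsing_inv_mul_cancel_right _ _ hHu, add_assoc, ← mul_add, add_sub_cancel,
      mul_sub, Matrix.nonsing_inv_mul _ hHu, sub_mul, one_mul,
      Matrix.mul_nonsing_inv_cancel_right _ _ hVu]
    abel
  have hassoc : Cstar = C + C * Uᵀ * (Chat⁻¹ * (V - Chat) * Chat⁻¹) * U * C := by
    simpa only [Matrix.mul_assoc] using hCstar
  have hmul : Cstar * (C⁻¹ + Uᵀ * (V⁻¹ - Chat⁻¹) * U) = 1 := by
    generalize V⁻¹ - Chat⁻¹ = D at hzero ⊢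
    generalize Chat⁻¹ * (V - Chat) * Chat⁻¹ = E at hzero hassoc
    rw [hassoc, mul_add, add_mul, add_mul, Matrix.mul_nonsing_inv _ hCu,
      Matrix.mul_nonsing_inv_cancel_right _ _ hCu]
    calc 1 + C * Uᵀ * E * U + (C * (Uᵀ * D * U) + C * Uᵀ * E * U * C * (Uᵀ * D * U))
        = 1 + C * Uᵀ * (D + E + E * (U * C * Uᵀ) * D) * U := by
          simp only [Matrix.mul_add, Matrix.add_mul, Matrix.mul_assoc]
          abel
      _ = 1 := by rw [← hChat, hzero, Matrix.mul_zero, Matrix.zero_mul, add_zero]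
  rw [Matrix.inv_eq_right_inv hmul, add_sub_cancel_left]
end
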